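/- Let d ≥ 1 and n ≥ 0 be natural numbers, let λ > 0 be a real number, and let x_1,…,x_n, θ, h ∈ ℝ^d and ξ_1,…,ξ_n ∈ ℝ. Define y_s = x_sᵀθ + ξ_s, V = λI + Σ_{s=1}^n x_s x_sᵀ, and the biased RLS estimate θ̂ʰ = V⁻¹(Σ_{s=1}^n x_s (y_s − x_sᵀh)) + h. Then, writing S = Σ_{s=1}^n ξ_s x_s, one has ‖θ̂ʰ − θ‖_V ≤ ‖S‖_{V⁻¹} + √λ · ‖θ − h‖₂, where ‖v‖_M = √(vᵀ M v) denotes the weighted norm induced by a positive definite matrix M and ‖·‖₂ is the Euclidean norm. -/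

import Mathlib

open Matrix Finset

/-- The weighted norm `‖v‖_M = √(vᵀ M v)` induced by a matrix `M`. -/
noncomputable def wNorm {d : ℕ} (M : Matrix (Fin d) (Fin d) ℝ) (v : Fin d → ℝ) : ℝ :=
  Real.sqrt (v ⬝ᵥ M.mulVec v)

/-- The Euclidean norm `‖v‖₂ = √(vᵀ v)`. -/
noncomputable def euclNorm {d : ℕ} (v : Fin d → ℝ) : ℝ :=
  Real.sqrt (v ⬝ᵥ v)

theorem wNorm_sub_le {d : ℕ} {M : Matrix (Fin d) (Fin d) ℝ} (hM : M.PosSemidef)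
    (u v : Fin d → ℝ) : wNorm M (u - v) ≤ wNorm M u + wNorm M v := by
  have hnonneg (w : Fin d → ℝ) : 0 ≤ w ⬝ᵥ M *ᵥ w := by
    simpa using hM.dotProduct_mulVec_nonneg w
  have hsymm (a b : Fin d → ℝ) : a ⬝ᵥ M *ᵥ b = b ⬝ᵥ M *ᵥ a := by
    have hT : Mᵀ = M := by simpa using hM.isHermitian.eq
    rw [dotProduct_mulVec, ← mulVec_transpose, hT, dotProduct_comm]
  have hcs : (u ⬝ᵥ M *ᵥ v) ^ 2 ≤ (u ⬝ᵥ M *ᵥ u) * (v ⬝ᵥ M *ᵥ v) := by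
    simpa only [Matrix.toLinearMap₂'_apply'] using
      LinearMap.BilinForm.apply_sq_le_of_symm (Matrix.toLinearMap₂' ℝ M)
        (fun w => by simpa only [Matrix.toLinearMap₂'_apply'] using hnonneg w)
        ⟨fun a b => by
          simpa only [Matrix.toLinearMap₂'_apply', RingHom.id_apply] using hsymm a b⟩ u v
  have habs : |u ⬝ᵥ M *ᵥ v| ≤ wNorm M u * wNorm M v := by
    rw [wNorm, wNorm, ← Real.sqrt_mul (hnonneg u)]
    exact Real.abs_le_sqrt hcs
  have hu : wNorm M u ^ 2 = u ⬝ᵥ M *ᵥ u := Real.sq_sqrt (hnonneg u)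
  have hv : wNorm M v ^ 2 = v ⬝ᵥ M *ᵥ v := Real.sq_sqrt (hnonneg v)
  refine Real.sqrt_le_iff.2 ⟨add_nonneg (Real.sqrt_nonneg _) (Real.sqrt_nonneg _), ?_⟩
  simp only [mulVec_sub, sub_dotProduct, dotProduct_sub]
  rw [hsymm v u]
  nlinarith [neg_abs_le (u ⬝ᵥ M *ᵥ v)]

theorem wNorm_inv_mulVec {d : ℕ} {V : Matrix (Fin d) (Fin d) ℝ} (hV : V.PosDef)
    (u : Fin d → ℝ) : wNorm V (V⁻¹ *ᵥ u) = wNorm V⁻¹ u := by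
  rw [wNorm, wNorm, mulVec_mulVec, mul_nonsing_inv V ((isUnit_iff_isUnit_det V).1 hV.isUnit),
    one_mulVec, dotProduct_comm]

/-- If `V ≥ lam I`, then the `V⁻¹`-norm of `lam b` is at most `√lam ‖b‖₂`. -/
theorem wNorm_inv_smul_le {d : ℕ} {V : Matrix (Fin d) (Fin d) ℝ} (hV : V.PosDef) {lam : ℝ}
    (hlam : 0 ≤ lam) (hle : ∀ w : Fin d → ℝ, lam * (w ⬝ᵥ w) ≤ w ⬝ᵥ V *ᵥ w) (b : Fin d → ℝ) :
    wNorm V⁻¹ (lam • b) ≤ Real.sqrt lam * euclNorm b := by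
  rw [wNorm, euclNorm, ← Real.sqrt_mul hlam]
  apply Real.sqrt_le_sqrt
  set w := V⁻¹ *ᵥ b with hw
  have hVw : V *ᵥ w = b := by
    rw [hw, mulVec_mulVec, mul_nonsing_inv V ((isUnit_iff_isUnit_det V).1 hV.isUnit), one_mulVec]
  have hsq : 0 ≤ (b - lam • w) ⬝ᵥ (b - lam • w) :=
    Finset.sum_nonneg fun i _ => mul_self_nonneg _
  have hlow := hle w
  rw [hVw, dotProduct_comm w b] at hlow
  simp only [sub_dotProduct, dotProduct_sub, smul_dotProduct, dotProduct_smul, smul_eq_mul,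
    dotProduct_comm w b] at hsq
  simp only [mulVec_smul, smul_dotProduct, dotProduct_smul, smul_eq_mul, ← hw]
  have hmul := mul_le_mul_of_nonneg_left hlow hlam
  exact mul_le_mul_of_nonneg_left (by linarith) hlam

/-- **Biased RLS confidence bound.**
For the linear model `y s = ⟪x s, θ⟫ + ξ s`, `V = λ I + ∑ x_s x_sᵀ` and the biased
regularized least-squares estimate `θ̂ʰ = V⁻¹ (∑ x_s (y_s − x_sᵀ h)) + h`, writing
`S = ∑ ξ_s x_s`, one has `‖θ̂ʰ − θ‖_V ≤ ‖S‖_{V⁻¹} + √λ ‖θ − h‖₂`. -/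
theorem biased_rls_confidence_bound
    (d n : ℕ) (hd : 1 ≤ d) (lam : ℝ) (hlam : 0 < lam)
    (x : Fin n → Fin d → ℝ) (θ h : Fin d → ℝ) (ξ : Fin n → ℝ)
    (y : Fin n → ℝ) (hy : ∀ s, y s = x s ⬝ᵥ θ + ξ s)
    (V : Matrix (Fin d) (Fin d) ℝ)
    (hV : V = lam • (1 : Matrix (Fin d) (Fin d) ℝ) + ∑ s, vecMulVec (x s) (x s))
    (θhat S : Fin d → ℝ)
    (hθhat : θhat = V⁻¹.mulVec (∑ s, (y s - x s ⬝ᵥ h) • x s) + h)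
    (hS : S = ∑ s, ξ s • x s) :
    wNorm V (θhat - θ) ≤ wNorm V⁻¹ S + Real.sqrt lam * euclNorm (θ - h) := by
  have hG : (∑ s, vecMulVec (x s) (x s)).PosSemidef :=
    posSemidef_sum _ fun s _ => by simpa using posSemidef_vecMulVec_self_star (x s)
  have hpos : V.PosDef := by
    rw [hV]
    exact (PosDef.one.smul hlam).add_posSemidef hG
  have hle (w : Fin d → ℝ) : lam * (w ⬝ᵥ w) ≤ w ⬝ᵥ V *ᵥ w := by
    have hw : 0 ≤ w ⬝ᵥ (∑ s, vecMulVec (x s) (x s)) *ᵥ w := by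
      simpa using hG.dotProduct_mulVec_nonneg w
    rw [hV, add_mulVec, dotProduct_add, smul_mulVec, one_mulVec, dotProduct_smul, smul_eq_mul]
    linarith
  have hsum : ∑ s, (y s - x s ⬝ᵥ h) • x s = S - lam • (θ - h) + V *ᵥ (θ - h) := by
    have hGv : (∑ s, vecMulVec (x s) (x s)) *ᵥ (θ - h) = ∑ s, (x s ⬝ᵥ (θ - h)) • x s := by
      simp only [sum_mulVec, vecMulVec_mulVec, op_smul_eq_smul]
    rw [hV, add_mulVec, smul_mulVec, one_mulVec, hGv, hS, ← add_assoc, sub_add_cancel,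
      ← Finset.sum_add_distrib]
    refine Finset.sum_congr rfl fun s _ => ?_
    rw [hy, dotProduct_sub, ← add_smul]
    congr 1
    ring
  have herr : θhat - θ = V⁻¹ *ᵥ (S - lam • (θ - h)) := by
    rw [hθhat, hsum, mulVec_add, mulVec_mulVec,
      nonsing_inv_mul V ((isUnit_iff_isUnit_det V).1 hpos.isUnit), one_mulVec]
    abel
  rw [herr, wNorm_inv_mulVec hpos]
  exact (wNorm_sub_le hpos.inv.posSemidef _ _).trans
    (by gcongr; exact wNorm_inv_smul_le hpos hlam.le hle _)
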